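/- Let p, t ∈ (0,1) with t ≥ 6p and p + t < 1. Then the Kullback-Leibler divergence D(p+t ‖ p) = (p+t)·ln((p+t)/p) + (1-p-t)·ln((1-p-t)/(1-p)) satisfies D(p+t ‖ p) > 3t/4. -/

import Mathlib

theorem stmt_4 (p t : ℝ) (hp : p ∈ Set.Ioo (0 : ℝ) 1) (ht : t ∈ Set.Ioo (0 : ℝ) 1)
    (htp : 6 * p ≤ t) (hpt : p + t < 1) :
    3 * t / 4 <
      (p + t) * Real.log ((p + t) / p) + (1 - p - t) * Real.log ((1 - p - t) / (1 - p)) := by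
  obtain ⟨hp0, hp1⟩ := hp
  obtain ⟨ht0, ht1⟩ := ht
  have h7 : (7 : ℝ) / 4 < Real.log 7 := by
    have h1 : Real.exp 7 < 7 ^ 4 := by
      have h2 : Real.exp 7 = Real.exp 1 ^ 7 := by
        rw [← Real.exp_nat_mul]; norm_num
      rw [h2]
      calc Real.exp 1 ^ 7 < (2.7182818286 : ℝ) ^ 7 :=
            pow_lt_pow_left₀ Real.exp_one_lt_d9 (Real.exp_pos 1).le (by norm_num)
        _ < 7 ^ 4 := by norm_num
    have h3 := (Real.lt_log_iff_exp_lt (by norm_num)).2 h1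
    rw [Real.log_pow] at h3
    push_cast at h3
    linarith
  have hA : Real.log 7 ≤ Real.log ((p + t) / p) := by
    apply Real.log_le_log (by norm_num)
    rw [le_div_iff₀ hp0]; linarith
  have hq : 0 < 1 - p - t := by linarith
  have hr : 0 < 1 - p := by linarith
  have hB : -t ≤ (1 - p - t) * Real.log ((1 - p - t) / (1 - p)) := by
    have h := Real.one_sub_inv_le_log_of_pos (div_pos hq hr)
    have h' := mul_le_mul_of_nonneg_left h hq.le
    have e : (1 - p - t) * (1 - ((1 - p - t) / (1 - p))⁻¹) = -t := by
      rw [inv_div]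
      field_simp
      ring
    linarith
  have hC : (p + t) * (7 / 4) ≤ (p + t) * Real.log ((p + t) / p) :=
    mul_le_mul_of_nonneg_left (by linarith) (by linarith)
  linarith
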